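/- Define F(p,z|τ) := θ(p+z|τ)/(θ(p|τ)·θ(z|τ)). For every τ in the upper half-plane and all complex numbers p, p′, z, z′ such that θ(p|τ), θ(p′|τ), θ(z|τ), θ(z′|τ), θ(p+p′|τ) and θ(z+z′|τ) are all nonzero, one has F(p,z|τ)·F(p+p′,z′|τ) − F(p′,z′|τ)·F(p,z+z′|τ) + F(p+p′,z+z′|τ)·F(p′,−z|τ) = 0. -/

import Mathlib

noncomputable section

open Complex

/-- `e(w) := exp(2πi·w)`. -/
def ce (w : ℂ) : ℂ := Complex.exp (2 * Real.pi * Complex.I * w)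

/-- The theta function
`θ(z|τ) := (1/(2πi))·(e(z/2) − e(−z/2))·∏_{j≥1}(1 − e(z+jτ))·∏_{j≥1}(1 − e(−z+jτ))`. -/
def theta (z τ : ℂ) : ℂ :=
  (1 / (2 * Real.pi * Complex.I)) * (ce (z / 2) - ce (-z / 2)) *
    ((∏' j : ℕ, (1 - ce (z + ((j : ℂ) + 1) * τ))) *
      ∏' j : ℕ, (1 - ce (-z + ((j : ℂ) + 1) * τ)))

/-- `F(p,z|τ) := θ(p+z|τ)/(θ(p|τ)·θ(z|τ))`. -/
def Ftheta (p z τ : ℂ) : ℂ := theta (p + z) τ / (theta p τ * theta z τ)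

open Filter Topology

/-- The finite q-Pochhammer symbol `(q;q)_n`. -/
def qfac (q : ℂ) (n : ℕ) : ℂ := ∏ j ∈ Finset.range n, (1 - q ^ (j + 1))

/-- The inverse of the q-Pochhammer symbol, extended by zero to negative integers. -/
def qinv (q : ℂ) (k : ℤ) : ℂ := if 0 ≤ k then (qfac q k.toNat)⁻¹ else 0

lemma one_sub_pow_ne {q : ℂ} (hq : ‖q‖ < 1) (j : ℕ) : 1 - q ^ (j + 1) ≠ 0 := by
  intro h
  have h1 : q ^ (j + 1) = 1 := (sub_eq_zero.mp h).symm
  have h2 : ‖q‖ ^ (j + 1) = 1 := by rw [← norm_pow, h1, norm_one]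
  have := pow_lt_one₀ (norm_nonneg q) hq (Nat.succ_ne_zero j)
  simp only [Nat.succ_eq_add_one] at this
  linarith

lemma qfac_ne {q : ℂ} (hq : ‖q‖ < 1) (n : ℕ) : qfac q n ≠ 0 :=
  Finset.prod_ne_zero_iff.mpr fun j _ => one_sub_pow_ne hq j

lemma qfac_succ (q : ℂ) (n : ℕ) : qfac q (n + 1) = qfac q n * (1 - q ^ (n + 1)) :=
  Finset.prod_range_succ _ _

lemma qinv_pred {q : ℂ} (hq : ‖q‖ < 1) (k : ℤ) :
    qinv q (k - 1) = (1 - q ^ k) * qinv q k := by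
  rcases lt_trichotomy k 0 with h | h | h
  · simp [qinv, not_le.mpr h, show ¬ (1 ≤ k) by omega]
  · subst h; simp [qinv]
  · obtain ⟨n, rfl⟩ : ∃ n : ℕ, k = n + 1 := ⟨(k - 1).toNat, by omega⟩
    have h1 : ((n : ℤ) + 1).toNat = n + 1 := by omega
    have h2 : (q ^ ((n : ℤ) + 1)) = q ^ (n + 1) := by exact_mod_cast zpow_natCast q (n + 1)
    have := one_sub_pow_ne hq n
    have := qfac_ne hq n
    rw [qinv, qinv, if_pos (by omega), if_pos (by omega), h1, h2, qfac_succ]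
    simp only [add_sub_cancel_right, Int.toNat_natCast]
    field_simp

lemma summable_norm_pow_aux {q : ℂ} (hq : ‖q‖ < 1) (c : ℂ) :
    Summable fun j : ℕ => ‖-(c * q ^ j)‖ := by
  simp only [norm_neg, norm_mul, norm_pow]
  exact (summable_geometric_of_lt_one (norm_nonneg _) hq).mul_left _

lemma multipliable_aux {q : ℂ} (hq : ‖q‖ < 1) (c : ℂ) :
    Multipliable fun j : ℕ => (1 - c * q ^ j) := by
  simpa [sub_eq_add_neg] using multipliable_one_add_of_summable (summable_norm_pow_aux hq c)

lemma qfac_tendsto {q : ℂ} (hq : ‖q‖ < 1) :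
    ∃ L : ℂ, L ≠ 0 ∧ Tendsto (qfac q) atTop (𝓝 L) := by
  refine ⟨∏' j : ℕ, (1 - q * q ^ j), ?_, ?_⟩
  · have := tprod_one_add_ne_zero_of_summable (f := fun j : ℕ => -(q * q ^ j)) (fun j => by
      have := one_sub_pow_ne hq j
      rwa [pow_succ', sub_eq_add_neg] at this) (summable_norm_pow_aux hq q)
    simpa [sub_eq_add_neg] using this
  · have := (multipliable_aux hq q).tendsto_prod_tprod_nat
    refine this.congr fun n => ?_
    simp [qfac, pow_succ']

lemma hasSum_congr_aux {ι : Type} {f g : ι → ℂ} {a b : ℂ} (h : HasSum f a) (h1 : ∀ n, g n = f n)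
    (h2 : b = a) : HasSum g b := by
  rw [h2, show g = f from funext h1]; exact h

/-- finite Jacobi triple product -/
lemma finite_triple {q x : ℂ} (hq : ‖q‖ < 1) (hq0 : q ≠ 0) (hx : x ≠ 0) (t : ℤ → ℂ)
    (t0 : t 0 = 1) (ht : ∀ n, t (n + 1) = -(x * q ^ (n + 1)) * t n) (N : ℕ) :
    HasSum (fun n : ℤ => qfac q (2 * N) * qinv q (N + n) * qinv q (N - n) * t n)
      ((∏ j ∈ Finset.range N, (1 - (x * q) * q ^ j)) *
        ∏ j ∈ Finset.range N, (1 - x⁻¹ * q ^ j)) := by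
  induction N with
  | zero =>
    have : ∀ n : ℤ, n ≠ 0 → qfac q (2 * 0) * qinv q ((0 : ℕ) + n) * qinv q ((0 : ℕ) - n) * t n = 0 := by
      intro n hn
      rcases lt_or_gt_of_ne hn with h | h
      · simp [qinv, not_le.mpr h]
      · simp [qinv, not_le.mpr h]
    convert hasSum_single 0 this using 1
    simp [qfac, qinv, t0]
  | succ N ih =>
    set c : ℤ → ℂ := fun n => qfac q (2 * N) * qinv q (N + n) * qinv q (N - n) with hc
    have h1 := ih.mul_left (1 + q ^ (2 * N + 1))
    have h2 := (Equiv.subRight (1 : ℤ)).hasSum_iff.mpr (ih.mul_left (x * q ^ (N + 1)))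
    have h3 := (Equiv.addRight (1 : ℤ)).hasSum_iff.mpr (ih.mul_left (x⁻¹ * q ^ N))
    have h4 := (h1.sub h2).sub h3
    refine (hasSum_congr_aux h4 ?_ ?_)
    · intro n
      simp only [Function.comp, Equiv.subRight_apply, Equiv.coe_addRight]
      have e1 := ht (n - 1)
      rw [sub_add_cancel] at e1
      have e2 := ht n
      have r1 := qinv_pred hq (N + 1 + n)
      have r2 := qinv_pred hq (N + n)
      have s1 := qinv_pred hq (N + 1 - n)
      have s2 := qinv_pred hq (N - n)
      have q1 : q ^ ((N : ℤ) + 1 + n) = q ^ N * q * q ^ n := by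
        rw [zpow_add₀ hq0, zpow_add₀ hq0]; simp
      have q2 : q ^ ((N : ℤ) + n) = q ^ N * q ^ n := by
        rw [zpow_add₀ hq0]; simp
      have q3 : q ^ ((N : ℤ) + 1 - n) = q ^ N * q / q ^ n := by
        rw [zpow_sub₀ hq0, zpow_add₀ hq0]; simp
      have q4 : q ^ ((N : ℤ) - n) = q ^ N / q ^ n := by
        rw [zpow_sub₀ hq0]; simp
      have hn0 : q ^ n ≠ 0 := zpow_ne_zero _ hq0
      rw [show (N : ℤ) + 1 + n - 1 = N + n by ring, q1] at r1
      rw [show (N : ℤ) + 1 - n - 1 = N - n by ring, q3] at s1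
      rw [q2, r1] at r2
      rw [q4, s1] at s2
      have f1 : qfac q (2 * (N + 1)) = qfac q (2 * N) * (1 - q ^ (2 * N + 1)) * (1 - q ^ (2 * N + 2)) := by
        rw [show 2 * (N + 1) = 2 * N + 1 + 1 by ring, qfac_succ, qfac_succ]
      have t1 : x * t (n - 1) = - (q ^ n)⁻¹ * t n := by
        rw [e1]; field_simp
      have t2 : x⁻¹ * t (n + 1) = - (q ^ n * q) * t n := by
        rw [e2, zpow_add_one₀ hq0]; field_simp
      push_cast
      rw [show (N : ℤ) + (n - 1) = N + n - 1 by ring, show (N : ℤ) - (n - 1) = N + 1 - n by ring,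
        show (N : ℤ) + (n + 1) = N + 1 + n by ring, show (N : ℤ) - (n + 1) = N - n - 1 by ring,
        r2, s2, r1, s1, f1]
      have g1 : ∀ a b c d : ℂ, x * a * (b * c * d * t (n - 1)) = a * b * c * d * (- (q ^ n)⁻¹ * t n) := by
        intro a b c d; rw [← t1]; ring
      have g2 : ∀ a b c d : ℂ, x⁻¹ * a * (b * c * d * t (n + 1)) = a * b * c * d * (- (q ^ n * q) * t n) := by
        intro a b c d; rw [← t2]; ring
      rw [g1, g2]
      field_simp
      ring
    · rw [Finset.prod_range_succ, Finset.prod_range_succ]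
      field_simp
      ring

lemma triple {q : ℂ} (hq : ‖q‖ < 1) (hq0 : q ≠ 0) :
    ∃ C : ℂ, ∀ x : ℂ, x ≠ 0 → ∀ t : ℤ → ℂ, t 0 = 1 →
      (∀ n, t (n + 1) = -(x * q ^ (n + 1)) * t n) → Summable t →
      (∏' j : ℕ, (1 - (x * q) * q ^ j)) * (∏' j : ℕ, (1 - x⁻¹ * q ^ j)) = C * ∑' n, t n := by
  obtain ⟨L, hL, hlim⟩ := qfac_tendsto hq
  have hinv : Tendsto (fun n => (qfac q n)⁻¹) atTop (𝓝 L⁻¹) := hlim.inv₀ hL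
  obtain ⟨B1, hB1⟩ := (Metric.isBounded_range_of_tendsto _ hlim).exists_norm_le
  obtain ⟨B2, hB2⟩ := (Metric.isBounded_range_of_tendsto _ hinv).exists_norm_le
  have hB1' : ∀ n, ‖qfac q n‖ ≤ B1 := fun n => hB1 _ ⟨n, rfl⟩
  have hB2' : ∀ n, ‖(qfac q n)⁻¹‖ ≤ B2 := fun n => hB2 _ ⟨n, rfl⟩
  have hB10 : 0 ≤ B1 := (norm_nonneg _).trans (hB1' 0)
  have hB20 : 0 ≤ B2 := (norm_nonneg _).trans (hB2' 0)
  have hB2'' : ∀ k, ‖qinv q k‖ ≤ B2 := by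
    intro k
    unfold qinv
    split_ifs
    · exact hB2' _
    · simpa using hB20
  refine ⟨L * L⁻¹ * L⁻¹, fun x hx t t0 ht hs => ?_⟩
  have hA := (multipliable_aux hq (x * q)).tendsto_prod_tprod_nat.mul
    (multipliable_aux hq x⁻¹).tendsto_prod_tprod_nat
  refine tendsto_nhds_unique hA ?_
  have hD := tendsto_tsum_of_dominated_convergence (𝓕 := (atTop : Filter ℕ))
    (f := fun (N : ℕ) (n : ℤ) => qfac q (2 * N) * qinv q (N + n) * qinv q (N - n) * t n)
    (g := fun n => L * L⁻¹ * L⁻¹ * t n) (bound := fun n => B1 * B2 * B2 * ‖t n‖)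
    (hs.norm.mul_left _) ?_ ?_
  · rw [tsum_mul_left] at hD
    refine hD.congr fun N => ?_
    exact (finite_triple hq hq0 hx t t0 ht N).tsum_eq
  · intro n
    have key : ∀ n : ℤ, Tendsto (fun N : ℕ => qinv q (N + n)) atTop (𝓝 L⁻¹) := by
      intro n
      have h1 : Tendsto (fun N : ℕ => ((N : ℤ) + n).toNat) atTop atTop := by
        refine tendsto_atTop.mpr fun b => ?_
        filter_upwards [eventually_ge_atTop (b + n.natAbs)] with N hN
        omega
      refine (hinv.comp h1).congr' ?_
      filter_upwards [eventually_ge_atTop n.natAbs] with N hN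
      simp only [Function.comp, qinv]
      rw [if_pos (by omega)]
    have k2 := key (-n)
    simp only [← sub_eq_add_neg] at k2
    have k0 : Tendsto (fun N : ℕ => qfac q (2 * N)) atTop (𝓝 L) :=
      hlim.comp (tendsto_id.const_mul_atTop' (by norm_num))
    exact ((k0.mul (key n)).mul k2).mul_const _
  · refine Eventually.of_forall fun N n => ?_
    rw [norm_mul, norm_mul, norm_mul]
    gcongr
    · exact hB1' _
    · exact hB2'' _
    · exact hB2'' _

lemma ce_add (a b : ℂ) : ce (a + b) = ce a * ce b := by
  simp only [ce, ← Complex.exp_add]; ring_nf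

lemma ce_ne (a : ℂ) : ce a ≠ 0 := Complex.exp_ne_zero _

lemma ce_neg (a : ℂ) : ce (-a) = (ce a)⁻¹ := by
  simp only [ce, ← Complex.exp_neg]; ring_nf

lemma ce_nat_mul (n : ℕ) (a : ℂ) : ce (n * a) = ce a ^ n := by
  simp only [ce, ← Complex.exp_nat_mul]; ring_nf

lemma ce_norm_lt {τ : ℂ} (hτ : 0 < τ.im) : ‖ce τ‖ < 1 := by
  rw [ce, Complex.norm_exp, Real.exp_lt_one_iff]
  simp
  positivity

lemma theta_series {τ : ℂ} (hτ : 0 < τ.im) :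
    ∃ C : ℂ, ∀ z, theta z τ = C * (ce (z / 2) * jacobiTheta₂ (z + τ / 2 + 1 / 2) τ) := by
  have hq := ce_norm_lt hτ
  have hq0 := ce_ne τ
  obtain ⟨C, hC⟩ := triple hq hq0
  refine ⟨1 / (2 * Real.pi * Complex.I) * C, fun z => ?_⟩
  have h := hC (ce z) (ce_ne z) (fun n => jacobiTheta₂_term n (z + τ / 2 + 1 / 2) τ)
    (by simp [jacobiTheta₂_term]) ?_ ((summable_jacobiTheta₂_term_iff _ _).mpr hτ)
  · rw [show ∑' n, jacobiTheta₂_term n (z + τ / 2 + 1 / 2) τ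
      = jacobiTheta₂ (z + τ / 2 + 1 / 2) τ from rfl] at h
    have e1 : ∀ j : ℕ, ce (z + ((j : ℂ) + 1) * τ) = ce z * ce τ * ce τ ^ j := by
      intro j
      rw [ce_add, add_mul, ce_add, ce_nat_mul, one_mul]; ring
    have e2 : ∀ j : ℕ, ce (-z + ((j : ℂ) + 1) * τ) = (ce z)⁻¹ * ce τ ^ (j + 1) := by
      intro j
      rw [ce_add, add_mul, ce_add, ce_nat_mul, one_mul, ce_neg]; ring
    have hm : Multipliable fun j : ℕ => (1 - (ce z)⁻¹ * ce τ ^ (j + 1)) := by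
      have := multipliable_aux hq ((ce z)⁻¹ * ce τ)
      refine this.congr fun j => ?_
      ring
    have hz0 : ∏' j : ℕ, (1 - (ce z)⁻¹ * ce τ ^ j) =
        (1 - (ce z)⁻¹ * ce τ ^ 0) * ∏' j : ℕ, (1 - (ce z)⁻¹ * ce τ ^ (j + 1)) :=
      tprod_eq_zero_mul' (f := fun j : ℕ => 1 - (ce z)⁻¹ * ce τ ^ j) hm
    rw [hz0] at h
    have e3 : ce (z / 2) - ce (-z / 2) = ce (z / 2) * (1 - (ce z)⁻¹ * ce τ ^ 0) := by
      have : -z / 2 = z / 2 + -z := by ring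
      rw [this, ce_add, ce_neg]; ring
    unfold theta
    simp only [e1, e2]
    rw [e3]
    linear_combination (1 / (2 * Real.pi * Complex.I)) * ce (z / 2) * h
  · intro n
    have : (ce τ) ^ (n + 1) = Complex.exp ((n + 1 : ℤ) * (2 * Real.pi * Complex.I * τ)) := by
      rw [Complex.exp_int_mul]; rfl
    rw [this, neg_mul, ← neg_one_mul, ← Complex.exp_pi_mul_I]
    simp only [ce, jacobiTheta₂_term, ← Complex.exp_add]
    congr 1
    push_cast
    ring

lemma theta_neg (z τ : ℂ) : theta (-z) τ = - theta z τ := by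
  unfold theta
  rw [neg_neg]
  ring

/-- the reindexing map -/
def reidx : (ℤ × ℤ) ⊕ (ℤ × ℤ) ≃ ℤ × ℤ := Equiv.ofBijective
  (Sum.elim (fun p => (p.1 + p.2, p.1 - p.2 - 1)) (fun p => (p.1 + p.2, p.1 - p.2))) (by
  constructor
  · rintro (⟨a, b⟩ | ⟨a, b⟩) (⟨c, d⟩ | ⟨c, d⟩) h <;>
      simp only [Sum.elim_inl, Sum.elim_inr, Prod.mk.injEq] at h
    · congr 2 <;> omega
    · omega
    · omega
    · congr 2 <;> omega
  · rintro ⟨n, m⟩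
    rcases Int.even_or_odd' (n - m) with ⟨b, hb | hb⟩
    · exact ⟨Sum.inr (n - b, b), by simp; omega⟩
    · exact ⟨Sum.inl (n - b, b), by simp; omega⟩)

lemma reidx_inl (a b : ℤ) : reidx (Sum.inl (a, b)) = (a + b, a - b - 1) := rfl

lemma reidx_inr (a b : ℤ) : reidx (Sum.inr (a, b)) = (a + b, a - b) := rfl

lemma jacobi_split {τ : ℂ} (hτ : 0 < τ.im) (x y : ℂ) :
    ce x * (jacobiTheta₂ (x + y + τ / 2 + 1 / 2) τ * jacobiTheta₂ (x - y + τ / 2 + 1 / 2) τ) =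
      -(jacobiTheta₂ (2 * x) (2 * τ) * (ce y * jacobiTheta₂ (2 * y + τ) (2 * τ))) +
      (ce x * jacobiTheta₂ (2 * x + τ) (2 * τ)) * jacobiTheta₂ (2 * y) (2 * τ) := by
  have hτ2 : 0 < (2 * τ).im := by simpa using hτ
  have S : ∀ z, Summable fun n => ‖jacobiTheta₂_term n z τ‖ :=
    fun z => ((summable_jacobiTheta₂_term_iff z τ).mpr hτ).norm
  have S2 : ∀ z, Summable fun n => ‖jacobiTheta₂_term n z (2 * τ)‖ :=
    fun z => ((summable_jacobiTheta₂_term_iff z (2 * τ)).mpr hτ2).norm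
  have P : ∀ z w, HasSum (fun p : ℤ × ℤ => jacobiTheta₂_term p.1 z τ * jacobiTheta₂_term p.2 w τ)
      (jacobiTheta₂ z τ * jacobiTheta₂ w τ) := by
    intro z w
    have h := (summable_mul_of_summable_norm (S z) (S w)).hasSum
    rwa [← tsum_mul_tsum_of_summable_norm (S z) (S w)] at h
  have P2 : ∀ z w, HasSum (fun p : ℤ × ℤ =>
      jacobiTheta₂_term p.1 z (2 * τ) * jacobiTheta₂_term p.2 w (2 * τ))
      (jacobiTheta₂ z (2 * τ) * jacobiTheta₂ w (2 * τ)) := by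
    intro z w
    have h := (summable_mul_of_summable_norm (S2 z) (S2 w)).hasSum
    rwa [← tsum_mul_tsum_of_summable_norm (S2 z) (S2 w)] at h
  have hL := reidx.hasSum_iff.mpr
    ((P (x + y + τ / 2 + 1 / 2) (x - y + τ / 2 + 1 / 2)).mul_left (ce x))
  have h1 := (P2 (2 * x) (2 * y + τ)).mul_left (-ce y)
  have h2 := (P2 (2 * x + τ) (2 * y)).mul_left (ce x)
  refine (hL.unique (HasSum.sum
    (a := -ce y * (jacobiTheta₂ (2 * x) (2 * τ) * jacobiTheta₂ (2 * y + τ) (2 * τ)))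
    (b := ce x * (jacobiTheta₂ (2 * x + τ) (2 * τ) * jacobiTheta₂ (2 * y) (2 * τ))) ?_ ?_)).trans ?_
  · refine hasSum_congr_aux h1 ?_ rfl
    rintro ⟨a, b⟩
    simp only [Function.comp, reidx_inl]
    rw [← neg_one_mul, ← Complex.exp_pi_mul_I]
    simp only [ce, jacobiTheta₂_term, ← Complex.exp_add]
    rw [Complex.exp_eq_exp_iff_exists_int]
    refine ⟨a - 1, ?_⟩
    push_cast
    ring
  · refine hasSum_congr_aux h2 ?_ rfl
    rintro ⟨a, b⟩
    simp only [Function.comp, reidx_inr]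
    simp only [ce, jacobiTheta₂_term, ← Complex.exp_add]
    rw [Complex.exp_eq_exp_iff_exists_int]
    refine ⟨a, ?_⟩
    push_cast
    ring
  · ring

lemma theta_plucker {τ : ℂ} (hτ : 0 < τ.im) : ∃ A B : ℂ → ℂ, ∀ x y,
    theta (x + y) τ * theta (x - y) τ = A x * B y - A y * B x := by
  obtain ⟨C, hC⟩ := theta_series hτ
  refine ⟨fun x => -C ^ 2 * jacobiTheta₂ (2 * x) (2 * τ),
    fun y => ce y * jacobiTheta₂ (2 * y + τ) (2 * τ), fun x y => ?_⟩
  have h := jacobi_split hτ x y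
  have e : ce x = ce ((x + y) / 2) * ce ((x - y) / 2) := by
    rw [← ce_add]; ring_nf
  rw [hC, hC]
  linear_combination C ^ 2 * h - C ^ 2 * (jacobiTheta₂ (x + y + τ / 2 + 1 / 2) τ *
    jacobiTheta₂ (x - y + τ / 2 + 1 / 2) τ) * e

lemma weierstrass {τ : ℂ} (hτ : 0 < τ.im) (p p' z z' : ℂ) :
    theta (p + z) τ * theta (p + p' + z') τ * theta p' τ * theta (z + z') τ
      - theta (p' + z') τ * theta (p + (z + z')) τ * theta z τ * theta (p + p') τ
      - theta (p + p' + (z + z')) τ * theta (p' + -z) τ * theta p τ * theta z' τ = 0 := by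
  obtain ⟨A, B, h⟩ := theta_plucker hτ
  set X := p + (p' + z' + z) / 2 with hX
  set Y := (p' + z' - z) / 2 with hY
  set U := (p' + z + z') / 2 with hU
  set V := (p' - z - z') / 2 with hV
  have hn := theta_neg z τ
  have a1 := h X Y
  have a2 := h U V
  have a3 := h X U
  have a4 := h Y V
  have a5 := h X V
  have a6 := h Y U
  rw [show X + Y = p + p' + z' by rw [hX, hY]; ring, show X - Y = p + z by rw [hX, hY]; ring] at a1
  rw [show U + V = p' by rw [hU, hV]; ring, show U - V = z + z' by rw [hU, hV]; ring] at a2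
  rw [show X + U = p + p' + (z + z') by rw [hX, hU]; ring, show X - U = p by rw [hX, hU]; ring] at a3
  rw [show Y + V = p' + -z by rw [hY, hV]; ring, show Y - V = z' by rw [hY, hV]; ring] at a4
  rw [show X + V = p + p' by rw [hX, hV]; ring, show X - V = p + (z + z') by rw [hX, hV]; ring] at a5
  rw [show Y + U = p' + z' by rw [hY, hU]; ring, show Y - U = -z by rw [hY, hU]; ring, hn] at a6
  have key : (theta (p + p' + z') τ * theta (p + z) τ) * (theta p' τ * theta (z + z') τ)
    - (theta (p + p' + (z + z')) τ * theta p τ) * (theta (p' + -z) τ * theta z' τ)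
    + (theta (p + p') τ * theta (p + (z + z')) τ) * (theta (p' + z') τ * -theta z τ) = 0 := by
    rw [a1, a2, a3, a4, a5, a6]; ring
  linear_combination key

/-- the Fay identity for `F`. -/
theorem statement7 (τ : ℂ) (hτ : 0 < τ.im) (p p' z z' : ℂ)
    (hp : theta p τ ≠ 0) (hp' : theta p' τ ≠ 0)
    (hz : theta z τ ≠ 0) (hz' : theta z' τ ≠ 0)
    (hpp' : theta (p + p') τ ≠ 0) (hzz' : theta (z + z') τ ≠ 0) :
    Ftheta p z τ * Ftheta (p + p') z' τ
      - Ftheta p' z' τ * Ftheta p (z + z') τ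
      + Ftheta (p + p') (z + z') τ * Ftheta p' (-z) τ = 0 := by
  have h := weierstrass hτ p p' z z'
  unfold Ftheta
  rw [theta_neg]
  field_simp
  linear_combination h
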